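/- Let α ∈ [0,1] and let φ : ℝ → ℝ be bounded and continuous. Set ∇P_tφ(0) = ∫_ℝ (y/(√(2π)·t^{3/2}))·exp(−y²/(2t))·φ(y) dy, the spatial derivative at 0 of the heat semigroup applied to φ. Then for every t > 0 the one-sided spatial derivatives of x ↦ Q_t φ(x) at 0 satisfy ∂_x Q_t φ(t,0+) = 2(1−α)·∇P_tφ(0) and ∂_x Q_t φ(t,0−) = 2α·∇P_tφ(0). -/

import Mathlib

open MeasureTheory Real Filter

/-- The Gaussian heat kernel `p(t,x,y) = (2πt)^{-1/2} exp(-(x-y)²/(2t))`. -/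
noncomputable def heatKernel (t x y : ℝ) : ℝ :=
  (Real.sqrt (2 * Real.pi * t))⁻¹ * Real.exp (-(x - y) ^ 2 / (2 * t))

/-- The transition kernel of the Skew Brownian motion of parameter `α`:
`q_α(t,x,y) = p(t,x,y) + (2α-1)·sgn(y)·(2πt)^{-1/2} exp(-(|x|+|y|)²/(2t))`. -/
noncomputable def skewKernel (α t x y : ℝ) : ℝ :=
  heatKernel t x y +
    (2 * α - 1) * Real.sign y * (Real.sqrt (2 * Real.pi * t))⁻¹ *
      Real.exp (-(|x| + |y|) ^ 2 / (2 * t))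

/-- The Skew Brownian motion semigroup applied to a function:
`Q_t φ(x) = ∫ q_α(t,x,y) φ(y) dy`. -/
noncomputable def skewSemigroup (α t : ℝ) (φ : ℝ → ℝ) (x : ℝ) : ℝ :=
  ∫ y, skewKernel α t x y * φ y

/-- A Gaussian centred at `z` with `|z| = |y|` is dominated by a centred Gaussian in `y`. -/
theorem exp_neg_sub_sq_le {t : ℝ} (ht : 0 < t) (x : ℝ) {y z : ℝ} (hz : |z| = |y|) :
    Real.exp (-(x - z) ^ 2 / (2 * t)) ≤
      Real.exp (x ^ 2 / (2 * t)) * Real.exp (-(1 / (4 * t)) * y ^ 2) := by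
  rw [← Real.exp_add, Real.exp_le_exp]
  have h : z ^ 2 = y ^ 2 := sq_eq_sq_iff_abs_eq_abs _ _ |>.2 hz
  have e : x ^ 2 / (2 * t) + -(1 / (4 * t)) * y ^ 2 = (x ^ 2 - z ^ 2 / 2) / (2 * t) := by
    rw [h]; field_simp; ring
  rw [e]
  gcongr
  nlinarith [sq_nonneg (2 * x - z)]

/-- A bounded measurable function is integrable against the Gaussians centred at `z y`. -/
theorem integrable_exp_neg_sub_sq_mul {t : ℝ} (ht : 0 < t) {z g : ℝ → ℝ} (hz : Measurable z)
    (hzy : ∀ y, |z y| = |y|) (hg : Measurable g) {M : ℝ} (hM : ∀ y, |g y| ≤ M) (x : ℝ) :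
    Integrable fun y => Real.exp (-(x - z y) ^ 2 / (2 * t)) * g y := by
  have h0 : Integrable fun y : ℝ => Real.exp (-(1 / (4 * t)) * y ^ 2) :=
    integrable_exp_neg_mul_sq (by positivity)
  refine ((h0.const_mul (Real.exp (x ^ 2 / (2 * t)))).mul_const M).mono'
    (by fun_prop) (ae_of_all _ fun y => ?_)
  rw [norm_mul, Real.norm_eq_abs, Real.norm_eq_abs, Real.abs_exp]
  exact mul_le_mul (exp_neg_sub_sq_le ht x (hzy y)) (hM y) (abs_nonneg _) (by positivity)

/-- Differentiation under the integral sign for Gaussians centred at `z y`. -/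
theorem hasDerivAt_integral_exp_neg_sub_sq_mul {t : ℝ} (ht : 0 < t) {z g : ℝ → ℝ}
    (hz : Measurable z) (hzy : ∀ y, |z y| = |y|) (hg : Measurable g) {M : ℝ}
    (hM : ∀ y, |g y| ≤ M) :
    HasDerivAt (fun x => ∫ y, Real.exp (-(x - z y) ^ 2 / (2 * t)) * g y)
      (∫ y, z y / t * Real.exp (-y ^ 2 / (2 * t)) * g y) 0 := by
  have h0 : Integrable fun y : ℝ => Real.exp (-(1 / (4 * t)) * y ^ 2) :=
    integrable_exp_neg_mul_sq (by positivity)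
  have h1 : Integrable fun y : ℝ => |y| * Real.exp (-(1 / (4 * t)) * y ^ 2) := by
    refine (integrable_mul_exp_neg_mul_sq (b := 1 / (4 * t)) (by positivity)).abs.congr
      (ae_of_all _ fun y => ?_)
    simp only [abs_mul, Real.abs_exp]
  have hbound : Integrable fun y : ℝ => ((1 + |y|) / t) *
      (Real.exp (1 / (2 * t)) * Real.exp (-(1 / (4 * t)) * y ^ 2)) * M := by
    refine (((h0.add h1).const_mul (Real.exp (1 / (2 * t)) / t)).mul_const M).congr
      (ae_of_all _ fun y => ?_)
    simp only [Pi.add_apply]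
    ring
  have key := (hasDerivAt_integral_of_dominated_loc_of_deriv_le (μ := volume) (x₀ := (0 : ℝ))
    (F := fun x y => Real.exp (-(x - z y) ^ 2 / (2 * t)) * g y)
    (F' := fun x y => (z y - x) / t * Real.exp (-(x - z y) ^ 2 / (2 * t)) * g y)
    (Metric.ball_mem_nhds 0 one_pos) (Eventually.of_forall fun x => by fun_prop)
    (integrable_exp_neg_sub_sq_mul ht hz hzy hg hM 0) (by fun_prop)
    (ae_of_all _ fun y x hx => ?_) hbound (ae_of_all _ fun y x _ => ?_)).2
  · refine key.congr_deriv ?_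
    congr 1 with y
    have : (0 - z y) ^ 2 = y ^ 2 := by
      rw [zero_sub, neg_sq]
      exact sq_eq_sq_iff_abs_eq_abs _ _ |>.2 (hzy y)
    rw [this, sub_zero]
  · have hx1 : |x| < 1 := by simpa using hx
    have hx2 : x ^ 2 ≤ 1 := (sq_le_one_iff_abs_le_one x).2 hx1.le
    rw [norm_mul, norm_mul, norm_div, Real.norm_eq_abs, Real.norm_eq_abs, Real.norm_eq_abs,
      Real.norm_eq_abs, Real.abs_exp, abs_of_pos ht]
    have ha : |z y - x| ≤ 1 + |y| := by
      have := abs_sub (z y) x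
      rw [hzy y] at this
      linarith
    have hb : Real.exp (-(x - z y) ^ 2 / (2 * t)) ≤
        Real.exp (1 / (2 * t)) * Real.exp (-(1 / (4 * t)) * y ^ 2) :=
      (exp_neg_sub_sq_le ht x (hzy y)).trans (by gcongr)
    have := hM y
    gcongr
  · have hd : HasDerivAt (fun x => -(x - z y) ^ 2 / (2 * t)) ((z y - x) / t) x := by
      have := (((hasDerivAt_id x).sub_const (z y)).pow 2).neg.div_const (2 * t)
      refine this.congr_deriv ?_
      simp only [id]
      field_simp
      push_cast
      ring
    refine (hd.exp.mul_const (g y)).congr_deriv ?_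
    ring

theorem Real.measurable_sign : Measurable Real.sign := by
  unfold Real.sign
  exact Measurable.ite measurableSet_Iio measurable_const
    (Measurable.ite measurableSet_Ioi measurable_const measurable_const)

/-- The integral obtained from the skew semigroup by replacing `|x|` with `s * x`, `s = ±1`,
is differentiable at the origin. -/
theorem hasDerivAt_skewSemigroup_branch (α : ℝ) {φ : ℝ → ℝ} (hφ : Measurable φ) {M : ℝ}
    (hM : ∀ x, |φ x| ≤ M) {t : ℝ} (ht : 0 < t) {s : ℝ} (hs : |s| = 1) :
    ∃ G : ℝ → ℝ, (∀ x, |x| = s * x → skewSemigroup α t φ x = G x) ∧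
      HasDerivAt G ((1 - s * (2 * α - 1)) *
        ∫ y, (y / (Real.sqrt (2 * Real.pi) * t ^ ((3 : ℝ) / 2))) *
          Real.exp (-y ^ 2 / (2 * t)) * φ y) 0 := by
  have hss : s * s = 1 := by rw [← abs_mul_abs_self, hs, one_mul]
  have hsign : ∀ y : ℝ, |Real.sign y| ≤ 1 := fun y => by
    rcases Real.sign_apply_eq y with h | h | h <;> simp [h]
  have hz : Measurable fun y : ℝ => -s * |y| := by fun_prop
  have hzy : ∀ y : ℝ, abs (-s * |y|) = |y| := fun y => by simp [abs_mul, hs]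
  have hg : Measurable fun y => Real.sign y * φ y := Real.measurable_sign.mul hφ
  have hgM : ∀ y, |Real.sign y * φ y| ≤ M := fun y => by
    rw [abs_mul]
    exact (mul_le_of_le_one_left (abs_nonneg _) (hsign y)).trans (hM y)
  set c := (Real.sqrt (2 * Real.pi * t))⁻¹ with hc
  refine ⟨fun x => c * (∫ y, Real.exp (-(x - y) ^ 2 / (2 * t)) * φ y) + (2 * α - 1) * c *
    ∫ y, Real.exp (-(x - -s * |y|) ^ 2 / (2 * t)) * (Real.sign y * φ y), fun x hx => ?_, ?_⟩
  · dsimp only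
    rw [skewSemigroup, ← integral_const_mul, ← integral_const_mul, ← integral_add
      ((integrable_exp_neg_sub_sq_mul (z := fun y => y) ht measurable_id (fun _ => rfl)
        hφ hM x).const_mul _)
      ((integrable_exp_neg_sub_sq_mul ht hz hzy hg hgM x).const_mul _)]
    congr 1 with y
    have : (|x| + |y|) ^ 2 = (x - -s * |y|) ^ 2 := by
      rw [hx]
      linear_combination (x ^ 2 - |y| ^ 2) * hss
    rw [skewKernel, heatKernel, this, ← hc]
    ring
  · refine (((hasDerivAt_integral_exp_neg_sub_sq_mul (z := fun y => y) ht measurable_id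
      (fun _ => rfl) hφ hM).const_mul c).add ((hasDerivAt_integral_exp_neg_sub_sq_mul ht hz hzy
      hg hgM).const_mul ((2 * α - 1) * c))).congr_deriv ?_
    have hsq : Real.sqrt (2 * Real.pi) * t ^ ((3 : ℝ) / 2) = Real.sqrt (2 * Real.pi * t) * t := by
      rw [Real.sqrt_mul (by positivity) t, show (3 : ℝ) / 2 = 1 / 2 + 1 by norm_num,
        Real.rpow_add_one ht.ne', Real.sqrt_eq_rpow t, mul_assoc]
    have e1 : (∫ y, (y / (Real.sqrt (2 * Real.pi) * t ^ ((3 : ℝ) / 2))) *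
        Real.exp (-y ^ 2 / (2 * t)) * φ y) =
        c * ∫ y, y / t * Real.exp (-y ^ 2 / (2 * t)) * φ y := by
      rw [← integral_const_mul]
      congr 1 with y
      rw [hsq, hc, div_eq_mul_inv, mul_inv]
      ring
    have e2 : (∫ y, -s * |y| / t * Real.exp (-y ^ 2 / (2 * t)) * (Real.sign y * φ y)) =
        -s * ∫ y, y / t * Real.exp (-y ^ 2 / (2 * t)) * φ y := by
      rw [← integral_const_mul]
      congr 1 with y
      have : |y| * Real.sign y = y := by
        rcases lt_trichotomy y 0 with h | h | h
        · simp [Real.sign_of_neg h, abs_of_neg h]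
        · simp [h]
        · simp [Real.sign_of_pos h, abs_of_pos h]
      linear_combination (-s / t * Real.exp (-y ^ 2 / (2 * t)) * φ y) * this
    rw [e1, e2]
    ring

theorem skewSemigroup_one_sided_derivatives (α : ℝ) (hα : α ∈ Set.Icc (0 : ℝ) 1)
    (φ : ℝ → ℝ) (hφc : Continuous φ) (hφb : ∃ M, ∀ x, |φ x| ≤ M)
    (t : ℝ) (ht : 0 < t) :
    Tendsto (fun h => (skewSemigroup α t φ h - skewSemigroup α t φ 0) / h)
        (nhdsWithin 0 (Set.Ioi 0))
        (nhds (2 * (1 - α) *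
          ∫ y, (y / (Real.sqrt (2 * Real.pi) * t ^ ((3 : ℝ) / 2))) *
            Real.exp (-y ^ 2 / (2 * t)) * φ y)) ∧
      Tendsto (fun h => (skewSemigroup α t φ h - skewSemigroup α t φ 0) / h)
        (nhdsWithin 0 (Set.Iio 0))
        (nhds (2 * α *
          ∫ y, (y / (Real.sqrt (2 * Real.pi) * t ^ ((3 : ℝ) / 2))) *
            Real.exp (-y ^ 2 / (2 * t)) * φ y)) := by
  obtain ⟨M, hM⟩ := hφb
  constructor
  · obtain ⟨G, hG, hd⟩ := hasDerivAt_skewSemigroup_branch α hφc.measurable hM ht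
      (s := 1) (by simp)
    rw [show 2 * (1 - α) = 1 - 1 * (2 * α - 1) by ring]
    refine (hd.tendsto_slope.mono_left (nhdsWithin_mono 0 fun x hx => ne_of_gt hx)).congr' ?_
    filter_upwards [self_mem_nhdsWithin] with x hx
    rw [hG x (by rw [one_mul, abs_of_pos hx]), hG 0 (by simp), slope_def_field, sub_zero]
  · obtain ⟨G, hG, hd⟩ := hasDerivAt_skewSemigroup_branch α hφc.measurable hM ht
      (s := -1) (by simp)
    rw [show 2 * α = 1 - -1 * (2 * α - 1) by ring]
    refine (hd.tendsto_slope.mono_left (nhdsWithin_mono 0 fun x hx => ne_of_lt hx)).congr' ?_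
    filter_upwards [self_mem_nhdsWithin] with x hx
    rw [hG x (by rw [neg_one_mul, abs_of_neg hx]), hG 0 (by simp), slope_def_field, sub_zero]
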